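/- arXiv:2204.11979 — 4 statements merged into one kernel-verified Lean document; each statement's English description precedes it below -/
import Mathlib

section
/- Let μ be a probability measure on ℝ and α ≥ 0 a real number such that M := ∫ exp(α y) dμ(y) is finite. Let ν_α be the exponentially tilted measure, i.e., the measure with density y ↦ exp(α y)/M with respect to μ. Then for every c ∈ ℝ, ν_α({y : y ≥ c}) ≥ μ({y : y ≥ c}); that is, the exponential tilt with α ≥ 0 puts more weight on larger values (first-order stochastic dominance). -/
open MeasureTheory Real

/-- A probability measure with a monotone density with respect to a probability measure `μ`
first-order stochastically dominates `μ`. -/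
theorem measure_Ici_le_withDensity_of_monotone {X : Type*} [LinearOrder X] [TopologicalSpace X]
    [ClosedIciTopology X] [MeasurableSpace X] [OpensMeasurableSpace X]
    (μ : Measure X) [IsProbabilityMeasure μ]
    {f : X → ENNReal} (hf : Monotone f) [IsProbabilityMeasure (μ.withDensity f)] (c : X) :
    μ (Set.Ici c) ≤ μ.withDensity f (Set.Ici c) := by
  have hS : MeasurableSet (Set.Ici c) := measurableSet_Ici
  rcases le_total 1 (f c) with h | h
  · rw [withDensity_apply _ hS, ← setLIntegral_one]
    exact setLIntegral_mono' hS fun y hy => h.trans (hf hy)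
  · have hcompl : μ.withDensity f (Set.Ici c)ᶜ ≤ μ (Set.Ici c)ᶜ := by
      rw [withDensity_apply _ hS.compl, ← setLIntegral_one]
      exact setLIntegral_mono' hS.compl fun y hy => (hf (not_le.mp hy).le).trans h
    rw [← compl_compl (Set.Ici c), prob_compl_eq_one_sub hS.compl, prob_compl_eq_one_sub hS.compl]
    exact tsub_le_tsub_left hcompl 1

/-- Exponential tilting with `α ≥ 0` first-order stochastically dominates the
original measure: `ν_α({y ≥ c}) ≥ μ({y ≥ c})` for all `c`. -/
theorem stmt1 (μ : Measure ℝ) [IsProbabilityMeasure μ] (α : ℝ) (hα : 0 ≤ α)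
    (hint : Integrable (fun y => Real.exp (α * y)) μ)
    (ν : Measure ℝ)
    (hν : ν = μ.withDensity
      (fun y => ENNReal.ofReal (Real.exp (α * y) / ∫ y', Real.exp (α * y') ∂μ))) :
    ∀ c : ℝ, μ {y | c ≤ y} ≤ ν {y | c ≤ y} := by
  intro c
  subst hν
  have : IsProbabilityMeasure (μ.withDensity
      (fun y => ENNReal.ofReal (Real.exp (α * y) / ∫ y', Real.exp (α * y') ∂μ))) :=
    isProbabilityMeasure_tilted hint
  have hM : 0 ≤ ∫ y', Real.exp (α * y') ∂μ := integral_nonneg fun _ => (Real.exp_pos _).le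
  refine measure_Ici_le_withDensity_of_monotone μ (fun x y hxy => ?_) c
  gcongr
end

section
/- Fix reals a < b, an integer p ≥ 1, and a continuous B : ℝ → ℝ^p. Let (Ω, 𝓕, P) be a probability space, let aΩ : Ω → ℝ be a bounded measurable function with ∫ aΩ dP = 0, and let Y : [a,b] × Ω → ℝ be jointly measurable and bounded. For ε ∈ ℝ define m_ε(t) := ∫_Ω Y(t,ω)(1 + ε · aΩ(ω)) dP(ω). Let s : ℝ → ℝ be twice continuously differentiable. Suppose γ : (−δ, δ) → ℝ^p (some δ > 0) is differentiable at 0 and for each ε satisfies the normal equations ∫_a^b ( m_ε(t) − s(γ(ε)ᵀ B(t)) ) · s'(γ(ε)ᵀ B(t)) · B(t) dt = 0. Write γ₀ := γ(0) and suppose the matrix V(γ₀) := ∫_a^b [ s'(γ₀ᵀB(t))² − s''(γ₀ᵀB(t)) ( m_0(t) − s(γ₀ᵀB(t)) ) ] B(t) B(t)ᵀ dt is invertible. Then γ'(0) = ∫_Ω φ(ω) aΩ(ω) dP(ω), where φ(ω) := ∫_a^b V(γ₀)⁻¹ ( Y(t,ω) − m_0(t) ) s'(γ₀ᵀB(t))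 B(t) dt. -/
open MeasureTheory intervalIntegral Matrix Function

/-- A bounded measurable scalar times an integrable function is integrable. -/
theorem integrable_smul_of_abs_le {α E : Type*} [MeasurableSpace α] [NormedAddCommGroup E]
    [NormedSpace ℝ E] {μ : Measure α} {w : α → ℝ} {f : α → E} {C : ℝ} (hw : Measurable w)
    (hC : ∀ x, |w x| ≤ C) (hf : Integrable f μ) : Integrable (fun x => w x • f x) μ := by
  refine (hf.norm.const_mul C).mono' (hw.aestronglyMeasurable.smul hf.1)
    (Filter.Eventually.of_forall fun x => ?_)
  rw [norm_smul, Real.norm_eq_abs]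
  exact mul_le_mul_of_nonneg_right (hC x) (norm_nonneg _)

/-- A bounded measurable scalar times a continuous function is interval integrable. -/
theorem intervalIntegrable_smul_of_abs_le {E : Type*} [NormedAddCommGroup E] [NormedSpace ℝ E]
    {w : ℝ → ℝ} {f : ℝ → E} {C : ℝ} (hw : Measurable w) (hC : ∀ t, |w t| ≤ C)
    (hf : Continuous f) (a b : ℝ) : IntervalIntegrable (fun t => w t • f t) volume a b :=
  ⟨integrable_smul_of_abs_le hw hC (hf.intervalIntegrable a b).1,
    integrable_smul_of_abs_le hw hC (hf.intervalIntegrable a b).2⟩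

/-- The linear functional `g ↦ g ⬝ᵥ v`. -/
noncomputable def dotProductRightCLM {p : ℕ} (v : Fin p → ℝ) : (Fin p → ℝ) →L[ℝ] ℝ :=
  ∑ i, v i • ContinuousLinearMap.proj i

theorem dotProductRightCLM_apply {p : ℕ} (v g : Fin p → ℝ) :
    dotProductRightCLM v g = g ⬝ᵥ v := by
  simp [dotProductRightCLM, dotProduct, mul_comm]

theorem continuous_dotProductRightCLM {p : ℕ} :
    Continuous (dotProductRightCLM (p := p)) := by
  unfold dotProductRightCLM
  fun_prop

/-- Differentiation under the integral sign along a curve that is differentiable at one point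
only. -/
theorem hasDerivAt_integral_mul_comp_dotProduct {a b : ℝ} {p : ℕ} {B : ℝ → Fin p → ℝ}
    (hB : Continuous B) {w : ℝ → ℝ} {C : ℝ} (hw : Measurable w) (hC : ∀ t, |w t| ≤ C)
    {c h : ℝ → ℝ} (hc : Continuous c) (hh : ContDiff ℝ 1 h)
    {γ : ℝ → Fin p → ℝ} {dγ : Fin p → ℝ} {x : ℝ} (hγ : HasDerivAt γ dγ x) :
    HasDerivAt (fun ε => ∫ t in a..b, w t * (c t * h (γ ε ⬝ᵥ B t)))
      (∫ t in a..b, w t * (c t * (deriv h (γ x ⬝ᵥ B t) * (dγ ⬝ᵥ B t)))) x := by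
  have hh' : Continuous (deriv h) := hh.continuous_deriv le_rfl
  have hC0 : 0 ≤ C := (abs_nonneg _).trans (hC 0)
  let G : (Fin p → ℝ) × ℝ → ((Fin p → ℝ) →L[ℝ] ℝ) := fun z =>
    (c z.2 * deriv h (z.1 ⬝ᵥ B z.2)) • dotProductRightCLM (B z.2)
  have hdot : Continuous fun z : (Fin p → ℝ) × ℝ => z.1 ⬝ᵥ B z.2 :=
    continuous_fst.dotProduct (hB.comp continuous_snd)
  have hG : Continuous G :=
    ((hc.comp continuous_snd).mul (hh'.comp hdot)).smul
      (continuous_dotProductRightCLM.comp (hB.comp continuous_snd))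
  have hpair : ∀ g : Fin p → ℝ, Continuous fun t : ℝ => (g, t) := fun g => by fun_prop
  have hF : ∀ g : Fin p → ℝ,
      IntervalIntegrable (fun t => w t * (c t * h (g ⬝ᵥ B t))) volume a b := fun g =>
    intervalIntegrable_smul_of_abs_le hw hC
      (hc.mul (hh.continuous.comp (hdot.comp (hpair g)))) a b
  have hF' : IntervalIntegrable (fun t => w t • G (γ x, t)) volume a b :=
    intervalIntegrable_smul_of_abs_le hw hC (hG.comp (hpair _)) a b
  obtain ⟨K, hK⟩ := ((isCompact_closedBall (γ x) 1).prod
    (isCompact_uIcc (a := a) (b := b))).exists_bound_of_continuousOn hG.continuousOn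
  have key : HasFDerivAt (fun g => ∫ t in a..b, w t * (c t * h (g ⬝ᵥ B t)))
      (∫ t in a..b, w t • G (γ x, t)) (γ x) := by
    refine intervalIntegral.hasFDerivAt_integral_of_dominated_of_fderiv_le
      (F' := fun g t => w t • G (g, t)) (bound := fun _ => C * K)
      (Metric.closedBall_mem_nhds (γ x) one_pos)
      (Filter.Eventually.of_forall fun g => (hF g).def'.1) (hF _) hF'.def'.1
      (Filter.Eventually.of_forall fun t ht g hg => ?_) intervalIntegrable_const
      (Filter.Eventually.of_forall fun t _ g _ => ?_)
    · rw [norm_smul, Real.norm_eq_abs]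
      exact mul_le_mul (hC t) (hK (g, t) ⟨hg, Set.uIoc_subset_uIcc ht⟩) (norm_nonneg _) hC0
    · have h1 : HasFDerivAt (fun g : Fin p → ℝ => g ⬝ᵥ B t) (dotProductRightCLM (B t)) g :=
        (dotProductRightCLM (B t)).hasFDerivAt.congr_of_eventuallyEq
          (Filter.Eventually.of_forall fun g => (dotProductRightCLM_apply _ g).symm)
      have h2 := ((((hh.differentiable one_ne_zero) (g ⬝ᵥ B t)).hasDerivAt.comp_hasFDerivAt g
        h1).const_mul (c t)).const_mul (w t)
      simp only [G, mul_smul]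
      exact h2
  have := key.comp_hasDerivAt x hγ
  rw [ContinuousLinearMap.intervalIntegral_apply hF'] at this
  refine this.congr_deriv (intervalIntegral.integral_congr fun t _ => ?_)
  simp only [G, _root_.smul_apply, dotProductRightCLM_apply, smul_eq_mul]
  ring

/-- Full-data influence function computation (step i of the proof of Theorem 1):
along the parametric submodel `dP_ε = (1 + ε aΩ) dP`, the least-squares
projection parameter `γ(ε)` solving the normal equations satisfies
`γ'(0) = E[φ · aΩ]` where
`φ(ω) = ∫_a^b V(γ₀)⁻¹ (Y(t,ω) − m₀(t)) s'(γ₀ᵀB(t)) B(t) dt`. -/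
theorem stmt5 (a b : ℝ) (hab : a < b) (p : ℕ) (hp : 1 ≤ p)
    (B : ℝ → Fin p → ℝ) (hB : Continuous B)
    (Ω : Type*) [MeasurableSpace Ω] (P : Measure Ω) [IsProbabilityMeasure P]
    (aΩ : Ω → ℝ) (haΩmeas : Measurable aΩ)
    (haΩbd : ∃ C, ∀ ω, |aΩ ω| ≤ C) (haΩmean : ∫ ω, aΩ ω ∂P = 0)
    (Y : ℝ → Ω → ℝ) (hYmeas : Measurable (uncurry Y))
    (hYbd : ∃ C, ∀ t ω, |Y t ω| ≤ C)
    (m : ℝ → ℝ → ℝ)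
    (hm : m = fun ε t => ∫ ω, Y t ω * (1 + ε * aΩ ω) ∂P)
    (s : ℝ → ℝ) (hs : ContDiff ℝ 2 s)
    (δ : ℝ) (hδ : 0 < δ)
    (γ : ℝ → Fin p → ℝ) (dγ : Fin p → ℝ) (hdγ : HasDerivAt γ dγ 0)
    (hnormal : ∀ ε ∈ Set.Ioo (-δ) δ, ∀ i,
      (∫ t in a..b, (m ε t - s (γ ε ⬝ᵥ B t)) * deriv s (γ ε ⬝ᵥ B t) * B t i) = 0)
    (V : Matrix (Fin p) (Fin p) ℝ)
    (hV : V = Matrix.of fun i j => ∫ t in a..b,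
      ((deriv s (γ 0 ⬝ᵥ B t)) ^ 2
        - deriv (deriv s) (γ 0 ⬝ᵥ B t) * (m 0 t - s (γ 0 ⬝ᵥ B t)))
        * (B t i * B t j))
    (hVinv : IsUnit V)
    (φ : Ω → Fin p → ℝ)
    (hφ : φ = fun ω => ∫ t in a..b,
      ((Y t ω - m 0 t) * deriv s (γ 0 ⬝ᵥ B t)) • (V⁻¹ *ᵥ B t)) :
    dγ = ∫ ω, aΩ ω • φ ω ∂P := by
  obtain ⟨Ca, hCa⟩ := haΩbd
  obtain ⟨CY, hCY⟩ := hYbd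
  have hYm : ∀ t, Measurable (Y t) := fun t => hYmeas.comp measurable_prodMk_left
  have hYi : ∀ t, Integrable (Y t) P := fun t =>
    Integrable.of_bound (hYm t).aestronglyMeasurable CY (Filter.Eventually.of_forall (hCY t))
  have hai : Integrable aΩ P :=
    Integrable.of_bound haΩmeas.aestronglyMeasurable Ca (Filter.Eventually.of_forall hCa)
  have hYai : ∀ t, Integrable (fun ω => Y t ω * aΩ ω) P := fun t =>
    integrable_smul_of_abs_le (hYm t) (hCY t) hai
  set m₁ : ℝ → ℝ := fun t => ∫ ω, Y t ω * aΩ ω ∂P with hm₁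
  have hmε : ∀ ε t, m ε t = m 0 t + ε * m₁ t := fun ε t => by
    simp only [hm, hm₁, zero_mul, add_zero, mul_one]
    rw [← MeasureTheory.integral_const_mul, ← MeasureTheory.integral_add (hYi t) ((hYai t).const_mul ε)]
    exact integral_congr_ae (Filter.Eventually.of_forall fun ω => by ring)
  have hm0 : m 0 = fun t => ∫ ω, Y t ω ∂P := by
    funext t; simp [hm]
  have hm0m : Measurable (m 0) := by
    rw [hm0]
    exact hYmeas.stronglyMeasurable.integral_prod_right.measurable
  have hm1m : Measurable m₁ := by
    have : Measurable (uncurry fun t ω => Y t ω * aΩ ω) :=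
      hYmeas.mul (haΩmeas.comp measurable_snd)
    exact this.stronglyMeasurable.integral_prod_right.measurable
  have hm0b : ∀ t, |m 0 t| ≤ CY := fun t => by
    have := norm_integral_le_of_norm_le_const (μ := P) (f := Y t) (C := CY)
      (Filter.Eventually.of_forall (hCY t))
    simpa [hm0] using this
  have hm1b : ∀ t, |m₁ t| ≤ CY * Ca := fun t => by
    have := norm_integral_le_of_norm_le_const (μ := P) (f := fun ω => Y t ω * aΩ ω)
      (C := CY * Ca) (Filter.Eventually.of_forall fun ω => by
        rw [norm_mul]
        exact mul_le_mul (hCY t ω) (hCa ω) (norm_nonneg _) ((abs_nonneg _).trans (hCY t ω)))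
    simpa [hm₁] using this
  have hs1 : ContDiff ℝ 1 s := hs.of_le one_le_two
  have hq : ContDiff ℝ 1 (deriv s) := (contDiff_succ_iff_deriv (n := 1)).1 hs |>.2.2
  have hq' : Continuous (deriv (deriv s)) := hq.continuous_deriv le_rfl
  have hr : ContDiff ℝ 1 fun u => s u * deriv s u := hs1.mul hq
  have hr' : ∀ u, deriv (fun u => s u * deriv s u) u
      = deriv s u ^ 2 + s u * deriv (deriv s) u := fun u => by
    rw [deriv_fun_mul (hs1.differentiable one_ne_zero u) (hq.differentiable one_ne_zero u)]
    ring
  have hBi : ∀ i, Continuous fun t => B t i := fun i => (continuous_apply i).comp hB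
  have hdot : ∀ g : Fin p → ℝ, Continuous fun t => g ⬝ᵥ B t := fun g =>
    continuous_const.dotProduct hB
  have hone : ∀ _ : ℝ, |(1 : ℝ)| ≤ 1 := fun _ => by simp
  -- differentiate the normal equations at `0`
  have hlin : ∀ i, (V *ᵥ dγ) i = ∫ t in a..b, m₁ t * (B t i * deriv s (γ 0 ⬝ᵥ B t)) := by
    intro i
    have d0 := hasDerivAt_integral_mul_comp_dotProduct (a := a) (b := b) hB hm0m hm0b (hBi i)
      hq hdγ
    have d1 := hasDerivAt_integral_mul_comp_dotProduct (a := a) (b := b) hB hm1m hm1b (hBi i)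
      hq hdγ
    have d2 := hasDerivAt_integral_mul_comp_dotProduct (a := a) (b := b) hB
      (measurable_const (a := (1 : ℝ))) hone (hBi i) hr hdγ
    have hD := (d0.add ((hasDerivAt_id (0 : ℝ)).mul d1)).sub d2
    have hz := hD.congr_of_eventuallyEq (f₁ := fun _ => (0 : ℝ)) (by
      filter_upwards [Ioo_mem_nhds (neg_lt_zero.2 hδ) hδ] with ε hε
      have h0 : IntervalIntegrable (fun t => m 0 t * (B t i * deriv s (γ ε ⬝ᵥ B t)))
          volume a b := intervalIntegrable_smul_of_abs_le hm0m hm0b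
            ((hBi i).mul (hq.continuous.comp (hdot _))) a b
      have h1 : IntervalIntegrable (fun t => m₁ t * (B t i * deriv s (γ ε ⬝ᵥ B t)))
          volume a b := intervalIntegrable_smul_of_abs_le hm1m hm1b
            ((hBi i).mul (hq.continuous.comp (hdot _))) a b
      have h2 : IntervalIntegrable (fun t => (1 : ℝ) * (B t i *
          (s (γ ε ⬝ᵥ B t) * deriv s (γ ε ⬝ᵥ B t)))) volume a b :=
        intervalIntegrable_smul_of_abs_le measurable_const hone
            ((hBi i).mul (hr.continuous.comp (hdot _))) a b
      simp only [Pi.sub_apply, Pi.add_apply, Pi.mul_apply, id]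
      rw [← intervalIntegral.integral_const_mul, ← intervalIntegral.integral_add h0
        (h1.const_mul ε), ← intervalIntegral.integral_sub (h0.add (h1.const_mul ε)) h2]
      refine (hnormal ε hε i).symm.trans (intervalIntegral.integral_congr fun t _ => ?_)
      simp only [hmε ε t]
      ring)
    have h0 := (hasDerivAt_const (0 : ℝ) (0 : ℝ)).unique hz
    simp only [id, one_mul, zero_mul, add_zero] at h0
    have hVi : (V *ᵥ dγ) i = (∫ t in a..b, B t i * (deriv (fun u => s u * deriv s u)
        (γ 0 ⬝ᵥ B t) * (dγ ⬝ᵥ B t))) - ∫ t in a..b, m 0 t * (B t i *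
          (deriv (deriv s) (γ 0 ⬝ᵥ B t) * (dγ ⬝ᵥ B t))) := by
      have hc2 : Continuous fun t => B t i * (deriv (fun u => s u * deriv s u)
          (γ 0 ⬝ᵥ B t) * (dγ ⬝ᵥ B t)) :=
        (hBi i).mul (((hr.continuous_deriv le_rfl).comp (hdot _)).mul (hdot _))
      have hi0 : IntervalIntegrable (fun t => m 0 t * (B t i *
          (deriv (deriv s) (γ 0 ⬝ᵥ B t) * (dγ ⬝ᵥ B t)))) volume a b :=
        intervalIntegrable_smul_of_abs_le hm0m hm0b
          ((hBi i).mul ((hq'.comp (hdot _)).mul (hdot _))) a b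
      rw [← intervalIntegral.integral_sub (hc2.intervalIntegrable a b) hi0]
      change ∑ j, V i j * dγ j = _
      simp only [hV, of_apply]
      simp_rw [← intervalIntegral.integral_mul_const]
      rw [← intervalIntegral.integral_finsetSum]
      · refine intervalIntegral.integral_congr fun t _ => ?_
        simp only [hr']
        rw [dotProduct.eq_1 dγ]
        simp only [Finset.mul_sum, ← Finset.sum_sub_distrib]
        refine Finset.sum_congr rfl fun j _ => ?_
        ring
      · intro j _
        have e1 : Continuous fun t => (deriv s (γ 0 ⬝ᵥ B t) ^ 2 +
            deriv (deriv s) (γ 0 ⬝ᵥ B t) * s (γ 0 ⬝ᵥ B t)) * (B t i * B t j) * dγ j :=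
          (((((hq.continuous.comp (hdot _)).pow 2).add ((hq'.comp (hdot _)).mul
            (hs1.continuous.comp (hdot _)))).mul ((hBi i).mul (hBi j))).mul continuous_const)
        have e2 : IntervalIntegrable (fun t => m 0 t * (deriv (deriv s) (γ 0 ⬝ᵥ B t) *
            (B t i * B t j) * dγ j)) volume a b :=
          intervalIntegrable_smul_of_abs_le hm0m hm0b
            (((hq'.comp (hdot _)).mul ((hBi i).mul (hBi j))).mul continuous_const) a b
        refine ((e1.intervalIntegrable a b).sub e2).congr fun t _ => ?_
        ring
    rw [hVi]
    linarith
  have hdet : IsUnit V.det := (Matrix.isUnit_iff_isUnit_det V).1 hVinv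
  have hsB : Continuous fun t => deriv s (γ 0 ⬝ᵥ B t) • B t :=
    (hq.continuous.comp (hdot _)).smul hB
  have hI : IntervalIntegrable (fun t => m₁ t • (deriv s (γ 0 ⬝ᵥ B t) • B t)) volume a b :=
    intervalIntegrable_smul_of_abs_le hm1m hm1b hsB a b
  have hvec : V *ᵥ dγ = ∫ t in a..b, m₁ t • (deriv s (γ 0 ⬝ᵥ B t) • B t) := by
    funext i
    rw [hlin i]
    refine Eq.trans (intervalIntegral.integral_congr fun t _ => ?_)
      ((ContinuousLinearMap.proj (R := ℝ) (φ := fun _ : Fin p => ℝ) i).intervalIntegral_comp_comm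
        hI)
    simp only [ContinuousLinearMap.proj_apply, Pi.smul_apply, smul_eq_mul]
    ring
  have hdγV : dγ = V⁻¹ *ᵥ (V *ᵥ dγ) := by
    rw [mulVec_mulVec, nonsing_inv_mul V hdet, one_mulVec]
  -- exchange the order of integration on the right-hand side
  let g : ℝ → Fin p → ℝ := fun t => deriv s (γ 0 ⬝ᵥ B t) • (V⁻¹ *ᵥ B t)
  have hg : Continuous g :=
    (hq.continuous.comp (hdot _)).smul (continuous_const.matrix_mulVec hB)
  have hprod : Integrable (uncurry fun t ω => (aΩ ω * (Y t ω - m 0 t)) • g t)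
      ((volume.restrict (Set.uIoc a b)).prod P) := by
    refine integrable_smul_of_abs_le (w := fun z : ℝ × Ω => aΩ z.2 * (Y z.1 z.2 - m 0 z.1))
      (C := Ca * (CY + CY)) (f := fun z => g z.1) ?_ (fun z => ?_)
      ((hg.intervalIntegrable a b).def'.comp_fst P)
    · exact (haΩmeas.comp measurable_snd).mul (hYmeas.sub (hm0m.comp measurable_fst))
    · rw [abs_mul]
      exact mul_le_mul (hCa _) ((abs_sub _ _).trans (add_le_add (hCY _ _) (hm0b _)))
        (abs_nonneg _) ((abs_nonneg _).trans (hCa z.2))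
  have hR : ∫ ω, aΩ ω • φ ω ∂P = ∫ t in a..b, m₁ t • g t := by
    have h1 : ∀ ω, aΩ ω • φ ω = ∫ t in a..b, (aΩ ω * (Y t ω - m 0 t)) • g t := fun ω => by
      rw [hφ, ← intervalIntegral.integral_smul]
      refine intervalIntegral.integral_congr fun t _ => ?_
      simp only [g, smul_smul, mul_assoc]
    simp_rw [h1]
    rw [← intervalIntegral_integral_swap hprod]
    refine intervalIntegral.integral_congr fun t _ => ?_
    rw [_root_.integral_smul_const]
    congr 1
    have : ∀ ω, aΩ ω * (Y t ω - m 0 t) = Y t ω * aΩ ω - aΩ ω * m 0 t := fun ω => by ring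
    simp_rw [this]
    rw [MeasureTheory.integral_sub (hYai t) (hai.mul_const _),
      MeasureTheory.integral_mul_const, haΩmean, zero_mul, sub_zero]
  rw [hdγV, hvec, hR]
  refine Eq.trans ((LinearMap.toContinuousLinearMap
    (Matrix.mulVecLin V⁻¹)).intervalIntegral_comp_comm hI).symm
    (intervalIntegral.integral_congr fun t _ => ?_)
  simp [g]
end

section
/- Fix reals a < b, an integer p ≥ 1, a continuous B : ℝ → ℝ^p, and a continuously differentiable s : ℝ → ℝ. Let (Ω, 𝓕, P) be a probability space, S : Ω → Finset ℝ a random finite set with S(ω) ⊆ [a,b], Y : ℝ × Ω → ℝ jointly measurable and bounded, ρ : ℝ × Ω → (0,∞) measurable, and e : ℝ × Ω → ℝ jointly measurable and bounded. Let β ∈ ℝ^p be such that: (a) ∫_Ω Y(t,ω) dP(ω) = s(βᵀ B(t)) for every t ∈ [a,b] (the structural assumption); (b) the matrix V(β) := ∫_a^b s'(βᵀB(t))² B(t) B(t)ᵀ dt is invertible, and set W(t) := s'(βᵀB(t)) · V(β)⁻¹ B(t); (c) the compensator (Campbell) identity E[ Σ_{u ∈ S} H(u,·) ] = E[ ∫_a^b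 H(t,·) ρ(t,·) dt ] holds for H(t,ω) := W(t) · ( Y(t,ω) − e(t,ω) ) / ρ(t,ω), with both sides finite; and (d) (t,ω) ↦ W(t)(Y(t,ω) − e(t,ω)) is P ⊗ Lebesgue-integrable on [a,b] × Ω. Then E[ Σ_{u ∈ S} W(u) (Y(u,·) − e(u,·))/ρ(u,·) + ∫_a^b W(t) ( e(t,·) − s(βᵀB(t)) ) dt ] = 0. -/
open MeasureTheory intervalIntegral Matrix Function

/-- A bounded jointly measurable scalar process times a continuous deterministic function is
integrable on the product of a bounded interval and a finite measure space. -/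
lemma integrable_smul_of_bounded_of_continuous {Ω E : Type*} [MeasurableSpace Ω]
    [NormedAddCommGroup E] [NormedSpace ℝ E] (P : Measure Ω) [IsFiniteMeasure P] (a b : ℝ)
    {X : ℝ → Ω → ℝ} (hX : Measurable (uncurry X)) (hbd : ∃ C, ∀ t ω, |X t ω| ≤ C)
    {W : ℝ → E} (hW : Continuous W) :
    Integrable (fun q : ℝ × Ω => X q.1 q.2 • W q.1) ((volume.restrict (Set.Ioc a b)).prod P) := by
  obtain ⟨C, hC⟩ := hbd
  have hWint : Integrable W (volume.restrict (Set.Ioc a b)) := hW.integrableOn_Ioc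
  exact (hWint.comp_fst P).bdd_smul C hX.aestronglyMeasurable
    (Filter.Eventually.of_forall fun q => hC q.1 q.2)

/-- A bounded jointly measurable process has integrable sections. -/
lemma integrable_section_of_bounded {Ω : Type*} [MeasurableSpace Ω] (P : Measure Ω)
    [IsFiniteMeasure P] {X : ℝ → Ω → ℝ} (hX : Measurable (uncurry X))
    (hbd : ∃ C, ∀ t ω, |X t ω| ≤ C) (t : ℝ) : Integrable (X t) P := by
  obtain ⟨C, hC⟩ := hbd
  exact .of_bound (hX.comp measurable_prodMk_left).aestronglyMeasurable C
    (Filter.Eventually.of_forall (hC t))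

/-- Mean-zero property of the influence function of Theorem 1: under the
structural assumption `E[Y(t)] = s(βᵀB(t))`, the compensator (Campbell)
identity for the assessment-time set `S` with intensity `ρ`, and suitable
integrability, the influence function
`Σ_{u∈S} W(u)(Y(u)−e(u))/ρ(u) + ∫_a^b W(t)(e(t) − s(βᵀB(t))) dt`
has expectation zero. -/
theorem stmt6 (a b : ℝ) (hab : a < b) (p : ℕ) (hp : 1 ≤ p)
    (B : ℝ → Fin p → ℝ) (hB : Continuous B)
    (s : ℝ → ℝ) (hs : ContDiff ℝ 1 s)
    (Ω : Type*) [MeasurableSpace Ω] (P : Measure Ω) [IsProbabilityMeasure P]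
    (S : Ω → Finset ℝ) (hS : ∀ ω, ∀ u ∈ S ω, u ∈ Set.Icc a b)
    (Y : ℝ → Ω → ℝ) (hYmeas : Measurable (uncurry Y))
    (hYbd : ∃ C, ∀ t ω, |Y t ω| ≤ C)
    (ρ : ℝ → Ω → ℝ) (hρmeas : Measurable (uncurry ρ)) (hρpos : ∀ t ω, 0 < ρ t ω)
    (e : ℝ → Ω → ℝ) (hemeas : Measurable (uncurry e))
    (hebd : ∃ C, ∀ t ω, |e t ω| ≤ C)
    (β : Fin p → ℝ)
    -- (a) structural assumption
    (hstruct : ∀ t ∈ Set.Icc a b, (∫ ω, Y t ω ∂P) = s (β ⬝ᵥ B t))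
    -- (b) Gram-type matrix invertible, and the weight function W
    (V : Matrix (Fin p) (Fin p) ℝ)
    (hV : V = Matrix.of fun i j =>
      ∫ t in a..b, (deriv s (β ⬝ᵥ B t)) ^ 2 * (B t i * B t j))
    (hVinv : IsUnit V)
    (W : ℝ → Fin p → ℝ) (hW : W = fun t => deriv s (β ⬝ᵥ B t) • (V⁻¹ *ᵥ B t))
    (H : ℝ → Ω → Fin p → ℝ)
    (hH : H = fun t ω => ((Y t ω - e t ω) / ρ t ω) • W t)
    -- (c) compensator (Campbell) identity, with both sides finite
    (hIntSum : Integrable (fun ω => ∑ u ∈ S ω, H u ω) P)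
    (hIntComp : Integrable (fun ω => ∫ t in a..b, ρ t ω • H t ω) P)
    (hCampbell : (∫ ω, (∑ u ∈ S ω, H u ω) ∂P)
      = ∫ ω, (∫ t in a..b, ρ t ω • H t ω) ∂P)
    -- (d) joint integrability
    (hdInt : Integrable (fun q : ℝ × Ω => (Y q.1 q.2 - e q.1 q.2) • W q.1)
      ((volume.restrict (Set.Icc a b)).prod P)) :
    (∫ ω, ((∑ u ∈ S ω, H u ω)
        + ∫ t in a..b, (e t ω - s (β ⬝ᵥ B t)) • W t) ∂P) = 0 := by
  have hWc : Continuous W := by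
    subst hW
    have hds : Continuous (deriv s) := hs.continuous_deriv le_rfl
    fun_prop
  have hsc : Continuous fun t => s (β ⬝ᵥ B t) := by
    have := hs.continuous
    fun_prop
  have hρH : ∀ t ω, ρ t ω • H t ω = (Y t ω - e t ω) • W t := by
    intro t ω
    rw [hH, smul_smul, mul_div_cancel₀ _ (hρpos t ω).ne']
  simp only [hρH] at hCampbell
  set ν : Measure ℝ := volume.restrict (Set.Ioc a b) with hν
  have hYW := integrable_smul_of_bounded_of_continuous P a b hYmeas hYbd hWc
  have heW := integrable_smul_of_bounded_of_continuous P a b hemeas hebd hWc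
  have hsW : Integrable (fun q : ℝ × Ω => s (β ⬝ᵥ B q.1) • W q.1) (ν.prod P) :=
    (hsc.smul hWc).integrableOn_Ioc.comp_fst P
  have h₁ : Integrable (fun q : ℝ × Ω => (Y q.1 q.2 - e q.1 q.2) • W q.1) (ν.prod P) := by
    simp only [sub_smul]
    exact hYW.sub heW
  have h₂ : Integrable (fun q : ℝ × Ω => (e q.1 q.2 - s (β ⬝ᵥ B q.1)) • W q.1) (ν.prod P) := by
    simp only [sub_smul]
    exact heW.sub hsW
  simp only [intervalIntegral.integral_of_le hab.le, ← hν] at hCampbell ⊢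
  rw [integral_add hIntSum h₂.integral_prod_right, hCampbell,
    ← integral_integral_swap (f := fun t ω => (Y t ω - e t ω) • W t) h₁,
    ← integral_integral_swap (f := fun t ω => (e t ω - s (β ⬝ᵥ B t)) • W t) h₂,
    ← integral_add h₁.integral_prod_left h₂.integral_prod_left]
  refine setIntegral_eq_zero_of_forall_eq_zero fun t ht => ?_
  have hYt := integrable_section_of_bounded P hYmeas hYbd t
  have het := integrable_section_of_bounded P hemeas hebd t
  simp only [_root_.integral_smul_const]
  rw [MeasureTheory.integral_sub hYt het, MeasureTheory.integral_sub het (integrable_const _),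
    hstruct t (Set.Ioc_subset_Icc_self ht), ← add_smul]
  simp
end

section
/- Fix reals a < b, an integer p ≥ 1, and a continuous B : ℝ → ℝ^p with Gram matrix V := ∫_a^b B(t) B(t)ᵀ dt invertible. Let (Ω, 𝓕, P) be a probability space, S : Ω → Finset ℝ a random finite set with S(ω) ⊆ [a,b], Y : ℝ × Ω → ℝ jointly measurable and bounded; let ρ, ρ̃ : ℝ × Ω → (0,∞) be measurable (true and model intensity processes) and e, ẽ : ℝ × Ω → ℝ jointly measurable and bounded (true and model conditional-mean processes), with ρ/ρ̃ bounded. Let β̃ ∈ ℝ^p, define β := V⁻¹ ∫_a^b B(t) ( ∫_Ω Y(t,ω) dP(ω) ) dt and φ̃(ω) := Σ_{u ∈ S(ω)} V⁻¹ B(u) ( Y(u,ω) − ẽ(u,ω) ) / ρ̃(u,ω) + ∫_a^b V⁻¹ B(t) ẽ(t,ω) dt − β̃. Assume: (i) the compensator (Campbell) identity E[ Σ_{u ∈ S} H(u,·) ] = E[ ∫_a^b H(t,·) ρ(t,·) dt ] holds for H(t,ω) := V⁻¹ B(t) ( Y(t,ω) − ẽ(t,ω) ) / ρ̃(t,ω),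 with both sides finite; (ii) for every t ∈ [a,b], E[ ( ρ(t,·)/ρ̃(t,·) ) ( Y(t,·) − e(t,·) ) ] = 0; and (iii) for every t ∈ [a,b], E[ e(t,·) ] = E[ Y(t,·) ]. Then β̃ − β + E[ φ̃ ] = E[ ∫_a^b V⁻¹ B(t) ( ρ(t,·)/ρ̃(t,·) − 1 ) ( e(t,·) − ẽ(t,·) ) dt ]. -/
open MeasureTheory intervalIntegral Matrix Function

section BoundedField

variable {Ω E : Type*} [MeasurableSpace Ω] {P : Measure Ω} [IsProbabilityMeasure P]
  [NormedAddCommGroup E] [NormedSpace ℝ E]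
  {F : ℝ → Ω → ℝ} {w : ℝ → E} {a b C : ℝ}

/-- A bounded jointly measurable real function of `(t, ω)` times a continuous vector function
of `t` is integrable on the product of a bounded interval and a probability space. -/
theorem integrable_prod_smul_of_bounded (hF : Measurable (uncurry F))
    (hC : ∀ t ω, |F t ω| ≤ C) (hw : Continuous w) :
    Integrable (uncurry fun t ω => F t ω • w t)
      ((volume.restrict (Set.Ioc a b)).prod P) := by
  have hwi : Integrable w (volume.restrict (Set.Ioc a b)) :=
    (hw.integrableOn_Icc (μ := volume)).mono_set Set.Ioc_subset_Icc_self
  exact (hwi.comp_fst P).bdd_smul C hF.aestronglyMeasurable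
    (Filter.Eventually.of_forall fun x => hC x.1 x.2)

theorem integrable_intervalIntegral_smul_of_bounded (hab : a ≤ b)
    (hF : Measurable (uncurry F)) (hC : ∀ t ω, |F t ω| ≤ C) (hw : Continuous w) :
    Integrable (fun ω => ∫ t in a..b, F t ω • w t) P := by
  simp only [intervalIntegral.integral_of_le hab]
  exact (integrable_prod_smul_of_bounded hF hC hw).integral_prod_right

theorem intervalIntegrable_integral_smul_of_bounded [CompleteSpace E] (hab : a ≤ b)
    (hF : Measurable (uncurry F)) (hC : ∀ t ω, |F t ω| ≤ C) (hw : Continuous w) :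
    IntervalIntegrable (fun t => (∫ ω, F t ω ∂P) • w t) volume a b := by
  rw [intervalIntegrable_iff_integrableOn_Ioc_of_le hab]
  simp only [← _root_.integral_smul_const]
  exact (integrable_prod_smul_of_bounded hF hC hw).integral_prod_left

theorem integral_intervalIntegral_smul_of_bounded [CompleteSpace E] (hab : a ≤ b)
    (hF : Measurable (uncurry F)) (hC : ∀ t ω, |F t ω| ≤ C) (hw : Continuous w) :
    (∫ ω, (∫ t in a..b, F t ω • w t) ∂P) = ∫ t in a..b, (∫ ω, F t ω ∂P) • w t := by
  simp only [intervalIntegral.integral_of_le hab, ← _root_.integral_smul_const]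
  exact (integral_integral_swap (integrable_prod_smul_of_bounded hF hC hw)).symm

theorem integrable_section_of_bounded_s8 (hF : Measurable (uncurry F))
    (hC : ∀ t ω, |F t ω| ≤ C) (t : ℝ) : Integrable (F t) P :=
  Integrable.of_bound (hF.comp measurable_prodMk_left).aestronglyMeasurable C
    (Filter.Eventually.of_forall (hC t))

end BoundedField

/-- The algebraic identity behind the product bias structure, in expectation: if `g` is
`r`-weighted mean-zero equivalent and mean equivalent to `y`, then `y` may be replaced
by `g`, leaving the product of the two errors. -/
theorem integral_product_bias {Ω : Type*} [MeasurableSpace Ω] {P : Measure Ω}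
    {r y g m : Ω → ℝ} (hg : Integrable g P) (hm : Integrable m P)
    (hry : Integrable (fun ω => r ω * (y ω - g ω)) P)
    (hrg : Integrable (fun ω => r ω * (g ω - m ω)) P)
    (hcond : (∫ ω, r ω * (y ω - g ω) ∂P) = 0) (htotal : (∫ ω, g ω ∂P) = ∫ ω, y ω ∂P) :
    (∫ ω, (r ω - 1) * (g ω - m ω) ∂P)
      = (∫ ω, r ω * (y ω - m ω) ∂P) + (∫ ω, m ω ∂P) - ∫ ω, y ω ∂P := by
  have h1 : (∫ ω, r ω * (y ω - m ω) ∂P)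
      = (∫ ω, r ω * (y ω - g ω) ∂P) + ∫ ω, r ω * (g ω - m ω) ∂P := by
    rw [← integral_add hry hrg]
    congr with ω
    ring
  have h2 : (∫ ω, (r ω - 1) * (g ω - m ω) ∂P)
      = (∫ ω, r ω * (g ω - m ω) ∂P) - ((∫ ω, g ω ∂P) - ∫ ω, m ω ∂P) := by
    have hgm : Integrable (fun ω => g ω - m ω) P := hg.sub hm
    rw [← integral_sub hg hm, ← integral_sub hrg hgm]
    congr with ω
    ring
  rw [h1, h2, hcond, htotal]
  ring

/-- Proposition 2 (remainder term of the von Mises expansion): with true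
nuisances `(ρ, e)` and model nuisances `(ρm, em)`,
`β̃ − β + E[φ̃] = E[∫_a^b V⁻¹B(t) (ρ/ρ̃ − 1)(e − ẽ) dt]`,
exhibiting the product (doubly-robust) bias structure. -/
theorem stmt8 (a b : ℝ) (hab : a < b) (p : ℕ) (hp : 1 ≤ p)
    (B : ℝ → Fin p → ℝ) (hB : Continuous B)
    (V : Matrix (Fin p) (Fin p) ℝ)
    (hV : V = Matrix.of fun i j => ∫ t in a..b, B t i * B t j)
    (hVinv : IsUnit V)
    (Ω : Type*) [MeasurableSpace Ω] (P : Measure Ω) [IsProbabilityMeasure P]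
    (S : Ω → Finset ℝ) (hS : ∀ ω, ∀ u ∈ S ω, u ∈ Set.Icc a b)
    (Y : ℝ → Ω → ℝ) (hYmeas : Measurable (uncurry Y))
    (hYbd : ∃ C, ∀ t ω, |Y t ω| ≤ C)
    (ρ ρm : ℝ → Ω → ℝ) (hρmeas : Measurable (uncurry ρ))
    (hρmmeas : Measurable (uncurry ρm))
    (hρpos : ∀ t ω, 0 < ρ t ω) (hρmpos : ∀ t ω, 0 < ρm t ω)
    (hratiobd : ∃ C, ∀ t ω, ρ t ω / ρm t ω ≤ C)
    (e em : ℝ → Ω → ℝ) (hemeas : Measurable (uncurry e))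
    (hemmeas : Measurable (uncurry em))
    (hebd : ∃ C, ∀ t ω, |e t ω| ≤ C) (hembd : ∃ C, ∀ t ω, |em t ω| ≤ C)
    (βm : Fin p → ℝ) (β : Fin p → ℝ)
    (hβ : β = ∫ t in a..b, (∫ ω, Y t ω ∂P) • (V⁻¹ *ᵥ B t))
    (φm : Ω → Fin p → ℝ)
    (hφm : φm = fun ω =>
      (∑ u ∈ S ω, ((Y u ω - em u ω) / ρm u ω) • (V⁻¹ *ᵥ B u))
        + (∫ t in a..b, em t ω • (V⁻¹ *ᵥ B t)) - βm)
    (H : ℝ → Ω → Fin p → ℝ)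
    (hH : H = fun t ω => ((Y t ω - em t ω) / ρm t ω) • (V⁻¹ *ᵥ B t))
    -- (i) compensator (Campbell) identity for the true intensity `ρ`
    (hIntSum : Integrable (fun ω => ∑ u ∈ S ω, H u ω) P)
    (hIntComp : Integrable (fun ω => ∫ t in a..b, ρ t ω • H t ω) P)
    (hCampbell : (∫ ω, (∑ u ∈ S ω, H u ω) ∂P)
      = ∫ ω, (∫ t in a..b, ρ t ω • H t ω) ∂P)
    -- (ii) `e` is a version of `E[Y(t)|Ō(t)]` and `ρ/ρm` depends on the past only
    (hcond : ∀ t ∈ Set.Icc a b, (∫ ω, (ρ t ω / ρm t ω) * (Y t ω - e t ω) ∂P) = 0)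
    -- (iii) law of total expectation
    (hTotal : ∀ t ∈ Set.Icc a b, (∫ ω, e t ω ∂P) = ∫ ω, Y t ω ∂P) :
    βm - β + (∫ ω, φm ω ∂P)
      = ∫ ω, (∫ t in a..b,
          ((ρ t ω / ρm t ω - 1) * (e t ω - em t ω)) • (V⁻¹ *ᵥ B t)) ∂P := by
  obtain ⟨CY, hCY⟩ := hYbd
  obtain ⟨Cr, hCr⟩ := hratiobd
  obtain ⟨Ce, hCe⟩ := hebd
  obtain ⟨Cm, hCm⟩ := hembd
  set w : ℝ → Fin p → ℝ := fun t => V⁻¹ *ᵥ B t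
  have hw : Continuous w := Continuous.matrix_mulVec continuous_const hB
  have hr : ∀ t ω, |ρ t ω / ρm t ω| ≤ Cr := fun t ω => by
    rw [abs_of_pos (div_pos (hρpos t ω) (hρmpos t ω))]
    exact hCr t ω
  have hrmeas : Measurable (uncurry fun t ω => ρ t ω / ρm t ω) := hρmeas.div hρmmeas
  have weighted_bound : ∀ {f g : ℝ → Ω → ℝ} {Cf Cg : ℝ}, (∀ t ω, |f t ω| ≤ Cf) →
      (∀ t ω, |g t ω| ≤ Cg) →
      ∀ t ω, |ρ t ω / ρm t ω * (f t ω - g t ω)| ≤ Cr * (Cf + Cg) := by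
    intro f g Cf Cg hf hg t ω
    rw [abs_mul]
    exact mul_le_mul (hr t ω) ((abs_sub _ _).trans (add_le_add (hf t ω) (hg t ω)))
      (abs_nonneg _) ((abs_nonneg _).trans (hr t ω))
  have hYm : Measurable (uncurry fun t ω => ρ t ω / ρm t ω * (Y t ω - em t ω)) :=
    hrmeas.mul (hYmeas.sub hemmeas)
  have hYe : Measurable (uncurry fun t ω => ρ t ω / ρm t ω * (Y t ω - e t ω)) :=
    hrmeas.mul (hYmeas.sub hemeas)
  have hee : Measurable (uncurry fun t ω => ρ t ω / ρm t ω * (e t ω - em t ω)) :=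
    hrmeas.mul (hemeas.sub hemmeas)
  have hprod : Measurable (uncurry fun t ω => (ρ t ω / ρm t ω - 1) * (e t ω - em t ω)) :=
    (hrmeas.sub measurable_const).mul (hemeas.sub hemmeas)
  have hprod_bound : ∀ t ω, |(ρ t ω / ρm t ω - 1) * (e t ω - em t ω)|
      ≤ (Cr + 1) * (Ce + Cm) := by
    intro t ω
    have h1 : |ρ t ω / ρm t ω - 1| ≤ Cr + 1 :=
      (abs_sub _ _).trans (by rw [abs_one]; exact add_le_add_left (hr t ω) 1)
    rw [abs_mul]
    exact mul_le_mul h1 ((abs_sub _ _).trans (add_le_add (hCe t ω) (hCm t ω)))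
      (abs_nonneg _) ((abs_nonneg _).trans h1)
  have hcomp : ∀ t ω, ρ t ω • H t ω = (ρ t ω / ρm t ω * (Y t ω - em t ω)) • w t := by
    intro t ω
    rw [hH, smul_smul]
    congr 1
    ring
  have hφ : (∫ ω, φm ω ∂P)
      = (∫ t in a..b, (∫ ω, ρ t ω / ρm t ω * (Y t ω - em t ω) ∂P) • w t)
        + (∫ t in a..b, (∫ ω, em t ω ∂P) • w t) - βm := by
    have hint := integrable_intervalIntegral_smul_of_bounded (P := P) hab.le hemmeas hCm hw
    have hsum : φm = fun ω => (∑ u ∈ S ω, H u ω) + (∫ t in a..b, em t ω • w t) - βm := by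
      rw [hφm, hH]
    have hadd : Integrable
        (fun ω => (∑ u ∈ S ω, H u ω) + ∫ t in a..b, em t ω • w t) P := hIntSum.add hint
    rw [hsum, integral_sub hadd (integrable_const _), integral_add hIntSum hint, hCampbell]
    simp only [hcomp, MeasureTheory.integral_const, probReal_univ, one_smul]
    rw [integral_intervalIntegral_smul_of_bounded hab.le hYm (weighted_bound hCY hCm) hw,
      integral_intervalIntegral_smul_of_bounded hab.le hemmeas hCm hw]
  have hiYm := intervalIntegrable_integral_smul_of_bounded (P := P) hab.le hYm
    (weighted_bound hCY hCm) hw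
  have him := intervalIntegrable_integral_smul_of_bounded (P := P) hab.le hemmeas hCm hw
  have hiY := intervalIntegrable_integral_smul_of_bounded (P := P) hab.le hYmeas hCY hw
  have hkey : (∫ t in a..b, (∫ ω, (ρ t ω / ρm t ω - 1) * (e t ω - em t ω) ∂P) • w t)
      = (∫ t in a..b, (∫ ω, ρ t ω / ρm t ω * (Y t ω - em t ω) ∂P) • w t)
        + (∫ t in a..b, (∫ ω, em t ω ∂P) • w t)
        - ∫ t in a..b, (∫ ω, Y t ω ∂P) • w t := by
    rw [← intervalIntegral.integral_add hiYm him,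
      ← intervalIntegral.integral_sub (hiYm.add him) hiY]
    refine intervalIntegral.integral_congr fun t ht => ?_
    rw [Set.uIcc_of_le hab.le] at ht
    have h := integral_product_bias (integrable_section_of_bounded_s8 hemeas hCe t)
      (integrable_section_of_bounded_s8 hemmeas hCm t)
      (integrable_section_of_bounded_s8 hYe (weighted_bound hCY hCe) t)
      (integrable_section_of_bounded_s8 hee (weighted_bound hCe hCm) t)
      (hcond t ht) (hTotal t ht)
    simp only [h, sub_smul, add_smul]
  rw [integral_intervalIntegral_smul_of_bounded hab.le hprod hprod_bound hw, hkey, hφ, hβ]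
  abel
end
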